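/- An irreducible Markov chain on the nonnegative integers is null recurrent if it is downward uniformly bounded, all mean drifts gamma_i are finite, and there exists N such that gamma_i = 0 for all i >= N. -/

import Mathlib

open scoped ENNReal BigOperators
open Filter

/-- A discrete-time Markov chain on the nonnegative integers, given by its
row-stochastic transition matrix. -/
structure MarkovChain where
  p : ℕ → ℕ → ℝ≥0∞
  row_sum : ∀ i, ∑' j, p i j = 1

namespace MarkovChain

/-- `n`-step transition probabilities. -/
noncomputable def step (M : MarkovChain) : ℕ → ℕ → ℕ → ℝ≥0∞
  | 0, i, j => if i = j then 1 else 0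
  | (n+1), i, j => ∑' k, M.p i k * M.step n k j

/-- Irreducibility: every state reaches every other state with positive probability. -/
def Irreducible (M : MarkovChain) : Prop := ∀ i j, ∃ n, 0 < M.step n i j

/-- Probability, starting from `j`, that the chain reaches state `i` for the first
time at time `n` (time `0` counts iff `j = i`). -/
noncomputable def hitAt (M : MarkovChain) (i : ℕ) : ℕ → ℕ → ℝ≥0∞
  | 0, j => if j = i then 1 else 0
  | (n+1), j => if j = i then 0 else ∑' k, M.p j k * M.hitAt i n k

/-- Probability that the first return to `i` occurs at time `n + 1`. -/
noncomputable def firstReturn (M : MarkovChain) (i n : ℕ) : ℝ≥0∞ :=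
  ∑' k, M.p i k * M.hitAt i n k

/-- The chain is recurrent: return to each state is almost sure. -/
def Recurrent (M : MarkovChain) : Prop := ∀ i, ∑' n, M.firstReturn i n = 1

/-- The chain is positive recurrent: recurrent with finite expected return times. -/
def PositiveRecurrent (M : MarkovChain) : Prop :=
  M.Recurrent ∧ ∀ i, ∑' n : ℕ, ((n : ℝ≥0∞) + 1) * M.firstReturn i n < ⊤

/-- Null recurrent: recurrent but not positive recurrent. -/
def NullRecurrent (M : MarkovChain) : Prop := M.Recurrent ∧ ¬ M.PositiveRecurrent

/-- The chain is transient: return to each state happens with probability `< 1`. -/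
def Transient (M : MarkovChain) : Prop := ∀ i, ∑' n, M.firstReturn i n < 1

/-- Mean drift at state `i`. -/
noncomputable def drift (M : MarkovChain) (i : ℕ) : ℝ :=
  ∑' j, (M.p i j).toReal * ((j : ℝ) - i)

/-- The mean drift at `i` is finite (well-defined). -/
def DriftFinite (M : MarkovChain) (i : ℕ) : Prop :=
  Summable fun j => (M.p i j).toReal * ((j : ℝ) - i)

/-- Second-moment drift at state `i`. -/
noncomputable def secondMoment (M : MarkovChain) (i : ℕ) : ℝ :=
  ∑' j, (M.p i j).toReal * ((j : ℝ) - i) ^ 2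

/-- Downward uniformly bounded with bound `k`: no downward jumps longer than `k`. -/
def DownwardBounded (M : MarkovChain) (k : ℕ) : Prop :=
  ∀ i j, j + k < i → M.p i j = 0

/-- Uniformly bounded with bound `d`: no jumps longer than `d`. -/
def UniformlyBounded (M : MarkovChain) (d : ℕ) : Prop :=
  ∀ i j : ℕ, (d : ℤ) < |(i : ℤ) - j| → M.p i j = 0

end MarkovChain

namespace MarkovChain

lemma exists_of_step_succ (M : MarkovChain) {n i j : ℕ} (h : 0 < M.step (n+1) i j) :
    ∃ l, M.p i l ≠ 0 ∧ 0 < M.step n l j := by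
  by_contra hcon
  push Not at hcon
  have : M.step (n+1) i j = 0 := by
    simp only [step]
    refine ENNReal.tsum_eq_zero.2 fun l => ?_
    by_cases hl : M.p i l = 0
    · simp [hl]
    · have := hcon l hl
      simp [le_antisymm this bot_le]
  exact h.ne' this

/-- Weighted averages of a constant. -/
lemma tsum_p_mul_const (M : MarkovChain) (i : ℕ) (c : ℝ≥0∞) : ∑' j, M.p i j * c = c := by
  rw [ENNReal.tsum_mul_right, M.row_sum, one_mul]

lemma eq_of_min (M : MarkovChain) (w : ℕ → ℝ≥0∞) (c : ℝ≥0∞) (hc : c ≠ ⊤)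
    (hmin : ∀ j, c ≤ w j) (j : ℕ) (hj : ∑' l, M.p j l * w l ≤ c) (l : ℕ) (hl : M.p j l ≠ 0) :
    w l = c := by
  by_contra hne
  have hlt : c < w l := lt_of_le_of_ne (hmin l) (Ne.symm hne)
  have hple : M.p j l ≤ 1 := by
    rw [← M.row_sum j]; exact ENNReal.le_tsum l
  have h1 : ∑' a, M.p j a * c < ∑' a, M.p j a * w a := by
    refine ENNReal.tsum_lt_tsum (i := l) ?_ (fun a => mul_le_mul_right (hmin a) _) ?_
    · rw [M.tsum_p_mul_const]; exact hc
    · exact ENNReal.mul_lt_mul_right hl (ne_top_of_le_ne_top ENNReal.one_ne_top hple) hlt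
  rw [M.tsum_p_mul_const] at h1
  exact absurd hj (not_le.2 h1)

/-- Minimum principle. -/
lemma min_principle (M : MarkovChain) (w : ℕ → ℝ≥0∞) (c : ℝ≥0∞) (hc : c ≠ ⊤)
    (hmin : ∀ j, c ≤ w j) (F : Set ℕ) (hF : ∀ j, j ∉ F → ∑' l, M.p j l * w l ≤ w j)
    (i : ℕ) (hi : i ∈ F) (n : ℕ) : ∀ j, 0 < M.step n j i → w j = c → ∃ a ∈ F, w a = c := by
  induction n with
  | zero =>
    intro j h hw
    have : j = i := by
      by_contra hne
      simp [step, hne] at h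
    exact ⟨j, this ▸ hi, hw⟩
  | succ n ih =>
    intro j h hw
    by_cases hj : j ∈ F
    · exact ⟨j, hj, hw⟩
    obtain ⟨l, hl, hs⟩ := M.exists_of_step_succ h
    exact ih l hs (M.eq_of_min w c hc hmin j (hw ▸ hF j hj) l hl)

lemma tsum_mul_nat (M : MarkovChain) (i : ℕ) (hf : M.DriftFinite i) (hd : M.drift i = 0) :
    ∑' j, M.p i j * (j : ℝ≥0∞) = i := by
  have hne : ∀ j, M.p i j ≠ ⊤ := fun j =>
    ne_top_of_le_ne_top ENNReal.one_ne_top (by rw [← M.row_sum i]; exact ENNReal.le_tsum j)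
  have hs : Summable fun j => (M.p i j).toReal :=
    ENNReal.summable_toReal (by rw [M.row_sum]; exact ENNReal.one_ne_top)
  have h1 : ∑' j, (M.p i j).toReal = 1 := by
    rw [← ENNReal.tsum_toReal_eq hne, M.row_sum]; simp
  have hs2 : HasSum (fun j => (M.p i j).toReal * (i : ℝ)) (i : ℝ) := by
    have := hs.hasSum.mul_right (i : ℝ)
    rwa [h1, one_mul] at this
  have hs3 : HasSum (fun j => (M.p i j).toReal * ((j : ℝ) - i)) 0 := by
    have := Summable.hasSum hf
    rw [drift] at hd
    rwa [hd] at this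
  have hs4 : HasSum (fun j : ℕ => (M.p i j).toReal * (j : ℝ)) (i : ℝ) := by
    have := hs3.add hs2
    rw [zero_add] at this
    convert this using 1
    funext j; ring
  have := ENNReal.ofReal_tsum_of_nonneg (f := fun j : ℕ => (M.p i j).toReal * (j : ℝ))
    (fun j => by positivity) hs4.summable
  rw [hs4.tsum_eq] at this
  rw [ENNReal.ofReal_natCast] at this
  rw [this]
  refine tsum_congr fun j => ?_
  rw [ENNReal.ofReal_mul ENNReal.toReal_nonneg, ENNReal.ofReal_toReal (hne j),
    ENNReal.ofReal_natCast]

/-- Hitting probability of `i` from `j`. -/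
noncomputable def hitProb (M : MarkovChain) (i j : ℕ) : ℝ≥0∞ := ∑' n, M.hitAt i n j

lemma hitProb_self (M : MarkovChain) (i : ℕ) : M.hitProb i i = 1 := by
  rw [hitProb, tsum_eq_zero_add' ENNReal.summable]
  simp [hitAt]

lemma hitProb_ne (M : MarkovChain) {i j : ℕ} (h : j ≠ i) :
    M.hitProb i j = ∑' l, M.p j l * M.hitProb i l := by
  rw [hitProb, tsum_eq_zero_add' ENNReal.summable]
  simp only [hitAt, h, if_false, zero_add]
  rw [ENNReal.tsum_comm]
  simp only [ENNReal.tsum_mul_left, hitProb]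

lemma hitProb_le_one (M : MarkovChain) (i j : ℕ) : M.hitProb i j ≤ 1 := by
  have key : ∀ n j, ∑ m ∈ Finset.range n, M.hitAt i m j ≤ 1 := by
    intro n
    induction n with
    | zero => simp
    | succ n ih =>
      intro j
      rw [Finset.sum_range_succ']
      by_cases h : j = i
      · simp [hitAt, h]
      · simp only [hitAt, h, if_false, add_zero]
        rw [← Summable.tsum_finsetSum (fun _ _ => ENNReal.summable)]
        simp only [← Finset.mul_sum]
        calc _ ≤ ∑' l, M.p j l * 1 := ENNReal.tsum_le_tsum fun l => mul_le_mul_right (ih l) _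
          _ = 1 := M.tsum_p_mul_const j 1
  rw [hitProb, ENNReal.tsum_eq_iSup_nat]
  exact iSup_le fun n => key n j

lemma hitProb_eq_one (M : MarkovChain) (hirr : M.Irreducible)
    (N : ℕ) (hd : ∀ j, N ≤ j → ∑' l, M.p j l * (l : ℝ≥0∞) = j) (i j : ℕ) :
    M.hitProb i j = 1 := by
  set u := M.hitProb i with hu
  have hule : ∀ j, u j ≤ 1 := M.hitProb_le_one i
  set K := max N (i+1) with hK
  obtain ⟨j1, hj1, hj1min⟩ := Finset.exists_min_image (Finset.range K) u ⟨0, by simp [hK]⟩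
  have hfin : ∀ j, u j ≠ ⊤ := fun j => ne_top_of_le_ne_top ENNReal.one_ne_top (hule j)
  have hmin : ∀ ε : NNReal, 0 < ε → ∀ j, u j1 ≤ u j + ε * j := by
    intro ε hε
    set w : ℕ → ℝ≥0∞ := fun j => u j + ε * j with hw
    obtain ⟨B, hB⟩ : ∃ B : ℕ, (1 : NNReal) / ε < B := exists_nat_gt _
    have hB1 : (1 : ℝ≥0∞) ≤ ε * B := by
      rw [div_lt_iff₀ hε] at hB
      have : (1 : NNReal) ≤ ε * B := by rw [mul_comm]; exact hB.le
      exact_mod_cast this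
    obtain ⟨j0, -, hj0⟩ := Finset.exists_min_image (Finset.range (B+1)) w ⟨0, by simp⟩
    have hj0min : ∀ j, w j0 ≤ w j := by
      intro j
      by_cases h : j < B + 1
      · exact hj0 j (Finset.mem_range.2 h)
      · calc w j0 ≤ w 0 := hj0 0 (by simp)
          _ ≤ 1 := by simpa [hw] using hule 0
          _ ≤ ε * B := hB1
          _ ≤ ε * j := by gcongr; omega
          _ ≤ w j := le_add_self
    obtain ⟨n, hn⟩ := hirr j0 i
    obtain ⟨a, ha, haw⟩ := M.min_principle w (w j0)
      (by simp only [hw]; exact ENNReal.add_ne_top.2 ⟨hfin _,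
            ENNReal.mul_ne_top ENNReal.coe_ne_top (ENNReal.natCast_ne_top _)⟩)
      hj0min {a | a < K} (by
        intro j hj
        simp only [Set.mem_ofPred_eq, not_lt] at hj
        have h1 : j ≠ i := by omega
        have h2 : N ≤ j := by omega
        apply le_of_eq
        simp only [hw, mul_add, ENNReal.tsum_add]
        rw [hu, M.hitProb_ne h1]
        congr 1
        rw [← hd j h2, ← ENNReal.tsum_mul_left]
        refine tsum_congr fun l => ?_
        ring) i (by simp [hK]) n j0 hn rfl
    intro j
    calc u j1 ≤ u a := hj1min a (Finset.mem_range.2 ha)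
      _ ≤ w a := le_self_add
      _ = w j0 := haw
      _ ≤ w j := hj0min j
  have hmin' : ∀ j, u j1 ≤ u j := by
    intro j
    refine ENNReal.le_of_forall_pos_le_add fun δ hδ _ => ?_
    have hpos : (0 : NNReal) < δ / (j + 1) := by positivity
    refine (hmin _ hpos j).trans ?_
    gcongr
    have : δ / (j + 1) * (j : NNReal) ≤ δ := by
      rw [div_mul_eq_mul_div, div_le_iff₀ (by positivity)]
      gcongr
      simp
    exact_mod_cast this
  obtain ⟨n, hn⟩ := hirr j1 i
  obtain ⟨a, ha, haw⟩ := M.min_principle u (u j1) (hfin _) hmin' {i} (by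
    intro j hj
    exact (M.hitProb_ne hj).ge) i rfl n j1 hn rfl
  rw [Set.mem_singleton_iff.1 ha, hu, M.hitProb_self] at haw
  exact le_antisymm (hule j) (haw ▸ hmin' j)

/-- Tail of the hitting time of `{0,…,N}`. -/
noncomputable def tail (M : MarkovChain) (N : ℕ) : ℕ → ℕ → ℝ≥0∞
  | 0, j => if j ≤ N then 0 else 1
  | (n+1), j => if j ≤ N then 0 else ∑' l, M.p j l * M.tail N n l

/-- Truncated mean hitting time. -/
noncomputable def trunc (M : MarkovChain) (N n j : ℕ) : ℝ≥0∞ :=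
  ∑ m ∈ Finset.range n, M.tail N m j

lemma trunc_le (M : MarkovChain) {N j : ℕ} (h : j ≤ N) (n : ℕ) : M.trunc N n j = 0 := by
  refine Finset.sum_eq_zero fun m _ => ?_
  cases m <;> simp [tail, h]

lemma trunc_succ (M : MarkovChain) {N j : ℕ} (h : ¬ j ≤ N) (n : ℕ) :
    M.trunc N (n+1) j = 1 + ∑' l, M.p j l * M.trunc N n l := by
  rw [trunc, Finset.sum_range_succ', add_comm]
  simp only [tail, h, if_false]
  rw [← Summable.tsum_finsetSum (fun _ _ => ENNReal.summable)]
  simp only [← Finset.mul_sum, trunc]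

/-- Mean hitting time of `{0,…,N}`. -/
noncomputable def meanHit (M : MarkovChain) (N j : ℕ) : ℝ≥0∞ := ∑' m, M.tail N m j

lemma meanHit_gt (M : MarkovChain) {N j : ℕ} (h : ¬ j ≤ N) :
    M.meanHit N j = 1 + ∑' l, M.p j l * M.meanHit N l := by
  rw [meanHit, tsum_eq_zero_add' ENNReal.summable]
  simp only [tail, h, if_false]
  rw [ENNReal.tsum_comm]
  simp only [ENNReal.tsum_mul_left, meanHit]

lemma meanHit_eq_iSup (M : MarkovChain) (N j : ℕ) :
    M.meanHit N j = ⨆ n, M.trunc N n j := ENNReal.tsum_eq_iSup_nat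

lemma meanHit_eq_top (M : MarkovChain) (k : ℕ) (hk : 0 < k) (hdb : M.DownwardBounded k)
    (N : ℕ) (hd : ∀ j, N ≤ j → ∑' l, M.p j l * (l : ℝ≥0∞) = j) (j : ℕ) (hj : N < j) :
    M.meanHit N j = ⊤ := by
  set g := M.meanHit N with hg
  have key : ∀ j, ¬ j ≤ N → (k : ℝ≥0∞) + ∑' l, M.p j l * (k * g l + N) = k * g j + N := by
    intro j hj
    simp only [mul_add, ENNReal.tsum_add, M.tsum_p_mul_const]
    rw [hg, M.meanHit_gt hj, mul_add, mul_one, add_assoc, ← ENNReal.tsum_mul_left]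
    congr 2
    exact tsum_congr fun l => by ring
  have low : ∀ n j : ℕ, ((min j (N + k * n) : ℕ) : ℝ≥0∞) ≤ k * g j + N := by
    intro n
    induction n with
    | zero =>
      intro j
      refine le_trans ?_ le_add_self
      exact_mod_cast (by simp)
    | succ n ih =>
      intro j
      by_cases h : j ≤ N
      · refine le_trans ?_ le_add_self
        exact_mod_cast (min_le_left _ _).trans h
      · rw [← key j h, ← M.tsum_p_mul_const j ((min j (N + k * (n+1)) : ℕ) : ℝ≥0∞)]
        have hk' := M.tsum_p_mul_const j (k : ℝ≥0∞)
        refine le_of_le_of_eq ?_ (congrArg (· + ∑' l, M.p j l * (k * g l + N)) hk')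
        change _ ≤ (∑' l, M.p j l * (k : ℝ≥0∞)) + _
        rw [← ENNReal.tsum_add]
        refine ENNReal.tsum_le_tsum fun l => ?_
        rw [← mul_add]
        by_cases hl : l + k < j
        · simp [hdb j l hl]
        · refine mul_le_mul_right ?_ _
          refine le_trans ?_ (add_le_add_right (ih l) _)
          norm_cast
          rw [Nat.mul_succ]
          omega
  have low' : ∀ j : ℕ, (j : ℝ≥0∞) ≤ k * g j + N := by
    intro j
    refine le_trans ?_ (low j j)
    have : j ≤ k * j := Nat.le_mul_of_pos_left j hk
    exact_mod_cast le_min le_rfl (by omega)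
  have up : ∀ n j : ℕ, k * M.trunc N n j + j ≤ k * g j + N := by
    intro n
    induction n with
    | zero => intro j; simpa [trunc] using low' j
    | succ n ih =>
      intro j
      by_cases h : j ≤ N
      · rw [M.trunc_le h, mul_zero, zero_add]
        exact low' j
      · rw [← key j h, M.trunc_succ h, mul_add, mul_one, add_assoc]
        gcongr
        nth_rewrite 1 [← hd j (by omega)]
        rw [← ENNReal.tsum_mul_left, ← ENNReal.tsum_add]
        refine ENNReal.tsum_le_tsum fun l => ?_
        calc _ = M.p j l * (k * M.trunc N n l + l) := by ring
          _ ≤ _ := mul_le_mul_right (ih l) _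
  by_contra htop
  have hfin : (k : ℝ≥0∞) * g j ≠ ⊤ := ENNReal.mul_ne_top (ENNReal.natCast_ne_top _) htop
  have h1 : (k : ℝ≥0∞) * g j + j ≤ k * g j + N := by
    conv_lhs => rw [hg, M.meanHit_eq_iSup, ENNReal.mul_iSup, ENNReal.iSup_add]
    exact iSup_le fun n => up n j
  have h2 : (j : ℝ≥0∞) ≤ N := (ENNReal.add_le_add_iff_left hfin).1 h1
  have h3 : j ≤ N := by exact_mod_cast h2
  omega

/-- Mean hitting time of `0`. -/
noncomputable def meanZero (M : MarkovChain) (j : ℕ) : ℝ≥0∞ := ∑' n : ℕ, (n : ℝ≥0∞) * M.hitAt 0 n j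

lemma shift_sum (M : MarkovChain) (h1 : ∀ l, M.hitProb 0 l = 1) (j : ℕ) :
    ∑' n : ℕ, ((n : ℝ≥0∞) + 1) * ∑' l, M.p j l * M.hitAt 0 n l
      = 1 + ∑' l, M.p j l * M.meanZero l := by
  simp only [← ENNReal.tsum_mul_left]
  rw [ENNReal.tsum_comm]
  conv_rhs => rw [← M.tsum_p_mul_const j 1, ← ENNReal.tsum_add]
  refine tsum_congr fun l => ?_
  have h2 : ∑' n, M.hitAt 0 n l = 1 := h1 l
  rw [← mul_add]
  refine Eq.trans ?_ (congrArg (fun x => M.p j l * (x + M.meanZero l)) h2)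
  simp only [meanZero]
  rw [← ENNReal.tsum_add, ← ENNReal.tsum_mul_left]
  exact tsum_congr fun n => by ring

lemma meanZero_ne (M : MarkovChain) (h1 : ∀ l, M.hitProb 0 l = 1) {j : ℕ} (hj : j ≠ 0) :
    M.meanZero j = 1 + ∑' l, M.p j l * M.meanZero l := by
  rw [← M.shift_sum h1, meanZero, tsum_eq_zero_add' ENNReal.summable]
  simp [hitAt, hj]

lemma reach_fin (M : MarkovChain) (g : ℕ → ℝ≥0∞) (h : ∀ j, g j ≠ ⊤ → ∑' l, M.p j l * g l ≠ ⊤)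
    (i n : ℕ) : ∀ j, 0 < M.step n j i → g j ≠ ⊤ → g i ≠ ⊤ := by
  induction n with
  | zero =>
    intro j hs hg
    have : j = i := by
      by_contra hne
      simp [step, hne] at hs
    exact this ▸ hg
  | succ n ih =>
    intro j hs hg
    obtain ⟨l, hl, hs'⟩ := M.exists_of_step_succ hs
    refine ih l hs' fun htop => ?_
    have := ENNReal.ne_top_of_tsum_ne_top (h j hg) l
    rw [htop, ENNReal.mul_top hl] at this
    exact this rfl

end MarkovChain

/-- an irreducible downward uniformly bounded chain with finite mean
drifts that vanish eventually is null recurrent. -/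
theorem stmt4 (M : MarkovChain) (hirr : M.Irreducible) (k : ℕ)
    (hdb : M.DownwardBounded k)
    (hfin : ∀ i, M.DriftFinite i)
    (N : ℕ) (hdrift : ∀ i, N ≤ i → M.drift i = 0) :
    M.NullRecurrent := by
  have hd : ∀ j, N ≤ j → ∑' l, M.p j l * (l : ℝ≥0∞) = j := fun j hj =>
    M.tsum_mul_nat j (hfin j) (hdrift j hj)
  have h1 : ∀ i j, M.hitProb i j = 1 := M.hitProb_eq_one hirr N hd
  refine ⟨fun i => ?_, fun hpos => ?_⟩
  · simp only [MarkovChain.firstReturn]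
    rw [ENNReal.tsum_comm]
    simp only [ENNReal.tsum_mul_left]
    change ∑' l, M.p i l * M.hitProb i l = 1
    simp only [h1, M.tsum_p_mul_const]
  have h0 := hpos.2 0
  simp only [MarkovChain.firstReturn] at h0
  rw [M.shift_sum (h1 0)] at h0
  have hz : M.meanZero 0 = 0 := by
    refine ENNReal.tsum_eq_zero.2 fun n => ?_
    cases n <;> simp [MarkovChain.hitAt]
  have hstep : ∀ j, M.meanZero j ≠ ⊤ → ∑' l, M.p j l * M.meanZero l ≠ ⊤ := by
    intro j hj
    by_cases hj0 : j = 0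
    · subst hj0
      exact ne_top_of_le_ne_top h0.ne le_add_self
    · rw [M.meanZero_ne (h1 0) hj0] at hj
      exact ne_top_of_le_ne_top hj le_add_self
  obtain ⟨n, hn⟩ := hirr 0 (N+1)
  refine M.reach_fin _ hstep (N+1) n 0 hn (by simp [hz]) ?_
  have hle : ∀ n j, M.trunc N n j ≤ M.meanZero j := by
    intro n
    induction n with
    | zero => simp [MarkovChain.trunc]
    | succ n ih =>
      intro j
      by_cases h : j ≤ N
      · simp [M.trunc_le h]
      · rw [M.trunc_succ h, M.meanZero_ne (h1 0) (by omega)]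
        gcongr
        exact ih _
  rw [eq_top_iff, ← M.meanHit_eq_top (k+1) (by omega)
    (fun i j hij => hdb i j (by omega)) N hd (N+1) (by omega), M.meanHit_eq_iSup]
  exact iSup_le fun n => hle n _
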